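/- arXiv:2605.02249 — 6 statements merged into one kernel-verified Lean document; each statement's English description precedes it below -/
import Mathlib

section
/- Let (M',s') = (M,s) + B_a φ be the expansion of a pointed Kripke model (M,s) by a first-degree belief formula B_a φ. Then for every belief formula ψ and every agent x ∈ A∖{a}: (M,s) ⊨ B_x ψ if and only if (M',s') ⊨ B_x ψ. In particular, expansion by B_a φ does not change the beliefs of any agent other than a. -/
/-- Propositional formulas over a set of propositions `P` (no modalities). -/
inductive PForm (P : Type) : Type
  | atom : P → PForm P
  | neg : PForm P → PForm P
  | and : PForm P → PForm P → PForm P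
  | or : PForm P → PForm P → PForm P

/-- Classical satisfaction of a propositional formula by a truth assignment `v ⊆ P`. -/
def PForm.sat {P : Type} (v : Set P) : PForm P → Prop
  | PForm.atom p => p ∈ v
  | PForm.neg φ => ¬ PForm.sat v φ
  | PForm.and φ ψ => PForm.sat v φ ∧ PForm.sat v ψ
  | PForm.or φ ψ => PForm.sat v φ ∨ PForm.sat v ψ

/-- Belief formulas over agents `A` and propositions `P`. -/
inductive BForm (A P : Type) : Type
  | atom : P → BForm A P
  | neg : BForm A P → BForm A P
  | and : BForm A P → BForm A P → BForm A P
  | or : BForm A P → BForm A P → BForm A P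
  | bel : A → BForm A P → BForm A P

/-- Embedding of propositional formulas into belief formulas. -/
def PForm.toB {A P : Type} : PForm P → BForm A P
  | PForm.atom p => BForm.atom p
  | PForm.neg φ => BForm.neg (PForm.toB φ)
  | PForm.and φ ψ => BForm.and (PForm.toB φ) (PForm.toB ψ)
  | PForm.or φ ψ => BForm.or (PForm.toB φ) (PForm.toB ψ)

/-- A multi-agent Kripke model: worlds, accessibility relations, valuation. -/
structure Kripke (A P : Type) where
  W : Type
  R : A → W → W → Prop
  val : W → Set P

/-- Satisfaction of a belief formula at a world of a Kripke model. -/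
def Kripke.sat {A P : Type} (M : Kripke A P) : M.W → BForm A P → Prop
  | w, BForm.atom p => p ∈ M.val w
  | w, BForm.neg φ => ¬ M.sat w φ
  | w, BForm.and φ ψ => M.sat w φ ∧ M.sat w ψ
  | w, BForm.or φ ψ => M.sat w φ ∨ M.sat w ψ
  | w, BForm.bel a φ => ∀ t, M.R a w t → M.sat t φ

/-- A pointed Kripke model. -/
structure PKripke (A P : Type) where
  M : Kripke A P
  s : M.W

/-- Membership of a belief formula in the belief set of a pointed Kripke model. -/
def PKripke.sat {A P : Type} (K : PKripke A P) (φ : BForm A P) : Prop :=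
  K.M.sat K.s φ

/-- First-degree subset relation between the belief sets of two pointed Kripke models. -/
def fdSub {A P : Type} (K₁ K₂ : PKripke A P) : Prop :=
  ∀ (a : A) (φ : PForm P),
    K₁.sat (BForm.bel a (PForm.toB φ)) → K₂.sat (BForm.bel a (PForm.toB φ))

/-- The expansion of the Kripke model `M` at `s` by the belief `B_a φ`:
worlds are the originals `Sum.inl u`, the replicas `Sum.inr (Sum.inl u)`, and the
fresh designated world `Sum.inr (Sum.inr ())`. -/
def Kripke.expand {A P : Type} (M : Kripke A P) (s : M.W) (a : A) (φ : PForm P) :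
    Kripke A P where
  W := M.W ⊕ (M.W ⊕ Unit)
  R := fun x w v =>
    match w, v with
    | Sum.inl u, Sum.inl v => M.R x u v
    | Sum.inr (Sum.inl u), Sum.inr (Sum.inl v) =>
        M.R x u v ∧ (x = a → PForm.sat (M.val v) φ)
    | Sum.inr (Sum.inr _), Sum.inl v => x ≠ a ∧ M.R x s v
    | Sum.inr (Sum.inr _), Sum.inr (Sum.inl v) =>
        x = a ∧ M.R a s v ∧ PForm.sat (M.val v) φ
    | _, _ => False
  val := fun w =>
    match w with
    | Sum.inl u => M.val u
    | Sum.inr (Sum.inl u) => M.val u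
    | Sum.inr (Sum.inr _) => M.val s

/-- Expansion of a pointed Kripke model by `B_a φ`. -/
def PKripke.expand {A P : Type} (K : PKripke A P) (a : A) (φ : PForm P) : PKripke A P :=
  ⟨K.M.expand K.s a φ, Sum.inr (Sum.inr ())⟩

/-- The generic minimal Kripke model: worlds `2^P`, total accessibility, identity valuation. -/
def Kripke.minimal (A P : Type) : Kripke A P where
  W := Set P
  R := fun _ _ _ => True
  val := id

open Classical in
/-- Full-meet multi-agent belief revision of a pointed Kripke model by `B_a φ`. -/
noncomputable def PKripke.fm {A P : Type} (K : PKripke A P) (a : A) (φ : PForm P) :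
    PKripke A P :=
  if K.sat (BForm.bel a (PForm.toB (PForm.neg φ)))
  then PKripke.expand ⟨Kripke.minimal A P, K.M.val K.s⟩ a φ
  else K.expand a φ

/-- The original worlds form a generated submodel of the expansion, so they satisfy the same
formulas there. -/
theorem Kripke.expand_sat_inl {A P : Type} (M : Kripke A P) (s : M.W) (a : A) (φ : PForm P)
    (ψ : BForm A P) (u : M.W) :
    (M.expand s a φ).sat (Sum.inl u) ψ ↔ M.sat u ψ := by
  induction ψ generalizing u with
  | atom p => exact Iff.rfl
  | neg ψ ih => exact not_congr (ih u)
  | and ψ χ ihψ ihχ => exact and_congr (ihψ u) (ihχ u)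
  | or ψ χ ihψ ihχ => exact or_congr (ihψ u) (ihχ u)
  | bel b ψ ih =>
    constructor
    · intro h t ht
      exact (ih t).1 (h (Sum.inl t) ht)
    · rintro h (t | t) ht
      · exact (ih t).2 (h t ht)
      · exact ht.elim

theorem expand_preserves_other_agents {A P : Type} [Fintype A] [Nonempty A] [Fintype P]
    (M : Kripke A P) (s : M.W) (a : A) (φ : PForm P)
    (x : A) (hx : x ≠ a) (ψ : BForm A P) :
    M.sat s (BForm.bel x ψ) ↔ (PKripke.expand ⟨M, s⟩ a φ).sat (BForm.bel x ψ) := by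
  constructor
  · rintro h (t | t | t) ht
    · exact (M.expand_sat_inl s a φ ψ t).2 (h t ht.2)
    · exact absurd ht.1 hx
    · exact ht.elim
  · intro h t ht
    exact (M.expand_sat_inl s a φ ψ t).1 (h (Sum.inl t) ⟨hx, ht⟩)
end

section
/- For every pointed Kripke model (M,s), every agent a ∈ A and every propositional formula φ, the expansion satisfies the new belief: (M,s) + B_a φ ⊨ B_a φ. -/
/-- Satisfaction of a propositional formula depends only on the valuation of the world. -/
theorem Kripke.sat_toB {A P : Type} (M : Kripke A P) (w : M.W) (φ : PForm P) :
    M.sat w (PForm.toB φ) ↔ PForm.sat (M.val w) φ := by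
  induction φ with
  | atom p => simp [PForm.toB, Kripke.sat, PForm.sat]
  | neg φ ih => simp [PForm.toB, Kripke.sat, PForm.sat, ih]
  | and φ ψ ihφ ihψ => simp [PForm.toB, Kripke.sat, PForm.sat, ihφ, ihψ]
  | or φ ψ ihφ ihψ => simp [PForm.toB, Kripke.sat, PForm.sat, ihφ, ihψ]

theorem expand_success {A P : Type} [Fintype A] [Nonempty A] [Fintype P]
    (M : Kripke A P) (s : M.W) (a : A) (φ : PForm P) :
    (PKripke.expand ⟨M, s⟩ a φ).sat (BForm.bel a (PForm.toB φ)) := by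
  unfold PKripke.sat
  rw [Kripke.sat]
  rintro (v | v | _) h
  · exact absurd rfl h.1
  · exact (Kripke.sat_toB _ _ φ).2 h.2.2
  · exact h.elim
end

section
/- Let (M',s') = (M,s) + B_a φ be the expansion of a pointed Kripke model (M,s) by a first-degree belief formula B_a φ, and suppose s' has at least one R'_a-successor in M'. Then for every propositional formula ψ: (M',s') ⊨ B_a ψ if and only if ψ is a classical propositional consequence of the set {φ} ∪ { χ | χ is a propositional formula and (M,s) ⊨ B_a χ }. -/
theorem Kripke.sat_bel_toB {A P : Type} (M : Kripke A P) (w : M.W) (a : A) (φ : PForm P) :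
    M.sat w (BForm.bel a (PForm.toB φ)) ↔ ∀ t, M.R a w t → PForm.sat (M.val t) φ :=
  forall₂_congr fun t _ => M.sat_toB t φ

theorem PKripke.expand_sat_bel_toB {A P : Type} (M : Kripke A P) (s : M.W) (a : A)
    (φ ψ : PForm P) :
    (PKripke.expand ⟨M, s⟩ a φ).sat (BForm.bel a (PForm.toB ψ)) ↔
      ∀ t, M.R a s t → PForm.sat (M.val t) φ → PForm.sat (M.val t) ψ := by
  refine (Kripke.sat_bel_toB _ _ a ψ).trans ⟨fun h t ht hφ => ?_, fun h t ht => ?_⟩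
  · exact h (Sum.inr (Sum.inl t)) ⟨rfl, ht, hφ⟩
  · rcases t with t | t | _
    · exact absurd rfl ht.1
    · exact h t ht.2.1 ht.2.2
    · exact ht.elim

theorem expand_first_degree_beliefs {A P : Type} [Fintype A] [Nonempty A] [Fintype P]
    (M : Kripke A P) (s : M.W) (a : A) (φ : PForm P)
    (h : ∃ u, (PKripke.expand ⟨M, s⟩ a φ).M.R a (PKripke.expand ⟨M, s⟩ a φ).s u)
    (ψ : PForm P) :
    (PKripke.expand ⟨M, s⟩ a φ).sat (BForm.bel a (PForm.toB ψ)) ↔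
      ∀ v : Set P,
        (PForm.sat v φ ∧
          ∀ χ : PForm P, M.sat s (BForm.bel a (PForm.toB χ)) → PForm.sat v χ) →
        PForm.sat v ψ := by
  rw [PKripke.expand_sat_bel_toB]
  constructor
  · rintro hψ v ⟨hφ, hv⟩
    have himp : PForm.sat v (PForm.or (PForm.neg φ) ψ) :=
      hv _ ((M.sat_bel_toB s a _).2 fun t ht => imp_iff_not_or.1 (hψ t ht))
    exact imp_iff_not_or.2 himp hφ
  · exact fun hψ t ht hφ => hψ _ ⟨hφ, fun χ hχ => (M.sat_bel_toB s a χ).1 hχ t ht⟩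
end

section
/- Full-meet multi-agent belief revision satisfies generalized DP3: for every pointed Kripke model (M,s) with belief set K = K_{(M,s)}, agents a, b ∈ A and propositional formulas φ, ψ, if B_a φ ∈ K *_fm B_b ψ then B_a φ ∈ (K *_fm B_a φ) *_fm B_b ψ. -/
/-- The valuations that agent `a` considers possible at the designated world. -/
def PKripke.possible {A P : Type} (K : PKripke A P) (a : A) : Set (Set P) :=
  {v | ∃ t, K.M.R a K.s t ∧ K.M.val t = v}

theorem PKripke.sat_bel_toB {A P : Type} (K : PKripke A P) (a : A) (φ : PForm P) :
    K.sat (BForm.bel a (PForm.toB φ)) ↔ ∀ v ∈ K.possible a, PForm.sat v φ := by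
  constructor
  · rintro h _ ⟨t, ht, rfl⟩
    exact (K.M.sat_toB t φ).1 (h t ht)
  · exact fun h t ht => (K.M.sat_toB t φ).2 (h _ ⟨t, ht, rfl⟩)

theorem PKripke.mem_possible_expand {A P : Type} (K : PKripke A P) (a x : A) (φ : PForm P)
    (v : Set P) :
    v ∈ (K.expand a φ).possible x ↔ v ∈ K.possible x ∧ (x = a → PForm.sat v φ) := by
  constructor
  · rintro ⟨t | t | t, ht, rfl⟩
    · exact ⟨⟨t, ht.2, rfl⟩, fun hx => absurd hx ht.1⟩
    · obtain ⟨rfl, hR, hφ⟩ := ht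
      exact ⟨⟨t, hR, rfl⟩, fun _ => hφ⟩
    · exact ht.elim
  · rintro ⟨⟨t, ht, rfl⟩, hφ⟩
    by_cases hx : x = a
    · subst hx
      exact ⟨Sum.inr (Sum.inl t), ⟨rfl, ht, hφ rfl⟩, rfl⟩
    · exact ⟨Sum.inl t, ⟨hx, ht⟩, rfl⟩

theorem Kripke.mem_possible_minimal {A P : Type} (s v : Set P) (x : A) :
    v ∈ PKripke.possible ⟨Kripke.minimal A P, s⟩ x :=
  ⟨v, trivial, rfl⟩

theorem PKripke.mem_possible_fm {A P : Type} (K : PKripke A P) (a x : A) (φ : PForm P)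
    (v : Set P) :
    v ∈ (K.fm a φ).possible x ↔
      ((∃ u ∈ K.possible a, PForm.sat u φ) → v ∈ K.possible x) ∧
        (x = a → PForm.sat v φ) := by
  have hneg : K.sat (BForm.bel a (PForm.toB (PForm.neg φ))) ↔
      ¬ ∃ u ∈ K.possible a, PForm.sat u φ := by
    rw [K.sat_bel_toB]
    simp [PForm.sat]
  unfold PKripke.fm
  split_ifs with hc
  · have hcons := hneg.1 hc
    simp only [PKripke.mem_possible_expand, Kripke.mem_possible_minimal, hcons, true_and,
      false_imp_iff]
  · have hcons := not_not.1 (mt hneg.2 hc)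
    simp only [PKripke.mem_possible_expand, hcons, true_imp_iff]

theorem fm_dp3 {A P : Type} [Fintype A] [Nonempty A] [Fintype P]
    (K : PKripke A P) (a b : A) (φ ψ : PForm P)
    (h : (K.fm b ψ).sat (BForm.bel a (PForm.toB φ))) :
    ((K.fm a φ).fm b ψ).sat (BForm.bel a (PForm.toB φ)) := by
  rw [PKripke.sat_bel_toB] at h ⊢
  intro v hv
  rw [PKripke.mem_possible_fm] at hv
  simp only [PKripke.mem_possible_fm] at h hv
  obtain ⟨hv, hvψ⟩ := hv
  by_cases hK : ∃ u ∈ K.possible b, PForm.sat u ψ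
  · have ⟨u, hu, huψ⟩ := hK
    refine (hv ⟨u, ⟨?_, ?_⟩, huψ⟩).2 trivial
    · exact fun _ => hu
    · rintro rfl
      exact h u ⟨fun _ => hu, fun _ => huψ⟩
  · exact h v ⟨fun hc => absurd hc hK, hvψ⟩
end

section
/- Full-meet multi-agent belief revision does not satisfy generalized DP2: if A contains at least two agents and P is nonempty, then there exist a pointed Kripke model (M,s) with belief set K = K_{(M,s)}, an agent a ∈ A and propositional formulas φ, ψ such that the belief formula B_a ψ → B_a ¬φ is valid in every pointed Kripke model (i.e., ψ propositionally entails ¬φ), but K *_fm B_a ψ ⊄ (K *_fm B_a φ) *_fm B_a ψ with respect to the first-degree subset relation; hence (K *_fm B_a φ) *_fm B_a ψ ≐ K *_fm B_a ψ fails. -/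
/-- An agent other than the revising one keeps its first-degree beliefs in an expansion. -/
theorem PKripke.expand_sat_bel_atom_of_ne {A P : Type} (K : PKripke A P) {a b : A} (h : b ≠ a)
    (φ : PForm P) (p : P) :
    (K.expand a φ).sat (BForm.bel b (BForm.atom p)) ↔ K.sat (BForm.bel b (BForm.atom p)) := by
  constructor
  · intro H t ht
    exact H (Sum.inl t) ⟨h, ht⟩
  · rintro H (t | t | t) ht
    · exact H t ht.2
    · exact absurd ht.1 h
    · exact ht.elim

/-- In the generic minimal model no agent believes an atom. -/
theorem Kripke.minimal_not_sat_bel_atom {A P : Type} (w : Set P) (b : A) (p : P) :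
    ¬ (PKripke.mk (Kripke.minimal A P) w).sat (BForm.bel b (BForm.atom p)) :=
  fun H => H (∅ : Set P) trivial

/-- Full-meet revision gives agents other than the revising one no new atomic beliefs. -/
theorem PKripke.sat_bel_atom_of_fm {A P : Type} (K : PKripke A P) {a b : A} (h : b ≠ a)
    (φ : PForm P) (p : P) (H : (K.fm a φ).sat (BForm.bel b (BForm.atom p))) :
    K.sat (BForm.bel b (BForm.atom p)) := by
  unfold PKripke.fm at H
  split_ifs at H
  · exact absurd ((expand_sat_bel_atom_of_ne _ h φ p).1 H) (Kripke.minimal_not_sat_bel_atom _ b p)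
  · exact (expand_sat_bel_atom_of_ne K h φ p).1 H

theorem fm_dp2_fails {A P : Type} [Fintype A] [Nonempty A] [Fintype P]
    (hA : ∃ a b : A, a ≠ b) (hP : Nonempty P) :
    ∃ (K : PKripke A P) (a : A) (φ ψ : PForm P),
      (∀ N : PKripke A P,
        N.sat (BForm.bel a (PForm.toB ψ)) →
          N.sat (BForm.bel a (PForm.toB (PForm.neg φ)))) ∧
      ¬ fdSub (K.fm a ψ) ((K.fm a φ).fm a ψ) := by
  obtain ⟨a, b, hab⟩ := hA
  obtain ⟨p⟩ := hP
  let K : PKripke A P := ⟨⟨Unit, fun _ _ _ => True, fun _ => {p}⟩, ()⟩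
  refine ⟨K, a, .neg (.atom p), .atom p, fun N hN t ht hn => hn (hN t ht), fun hsub => ?_⟩
  have hψ : ¬ K.sat (BForm.bel a (PForm.toB (.neg (.atom p)))) :=
    fun H => H () trivial rfl
  have hφ : K.sat (BForm.bel a (PForm.toB (.neg (.neg (.atom p))))) :=
    fun _ _ hn => hn rfl
  have hK : (K.fm a (.atom p)).sat (BForm.bel b (BForm.atom p)) := by
    rw [PKripke.fm, if_neg hψ]
    exact (K.expand_sat_bel_atom_of_ne hab.symm _ p).2 fun _ _ => rfl
  have H := PKripke.sat_bel_atom_of_fm _ hab.symm _ p (hsub b (.atom p) hK)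
  rw [PKripke.fm, if_pos hφ] at H
  exact Kripke.minimal_not_sat_bel_atom _ b p
    ((PKripke.expand_sat_bel_atom_of_ne _ hab.symm _ p).1 H)
end

section
/- Let the set of inference rules R be empty, let u be an interpretation (a consistent complete set of literals over P), and let φ and ψ be consistent sets of literals. Then: (i) the set u' = (u ∖ ¬φ) ∪ φ is an interpretation and satisfies u' = C_∅((u ∩ u') ∪ φ), so u ⋆ φ = (u ∖ ¬φ) ∪ φ; (ii) if every literal of ψ belongs to u ∖ ¬φ, then u ⋆ (φ ∪ ψ) = (u ⋆ φ) ∪ ψ; and (iii) if (u ⋆ φ) ∪ ψ is consistent, then (u ⋆ φ) ∪ ψ = u ⋆ (φ ∪ ψ). -/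
/-- A literal over `P`: a proposition together with a polarity. -/
abbrev Lit (P : Type) := P × Bool

/-- Negation of a literal (so `¬¬ℓ = ℓ`). -/
def Lit.negate {P : Type} (l : Lit P) : Lit P := (l.1, !l.2)

/-- `¬S = {¬ℓ | ℓ ∈ S}` for a set of literals `S`. -/
def negSet {P : Type} (S : Set (Lit P)) : Set (Lit P) := Lit.negate '' S

/-- A set of literals is consistent if it contains no pair `ℓ, ¬ℓ`. -/
def ConsistentLits {P : Type} (S : Set (Lit P)) : Prop :=
  ∀ l ∈ S, l.negate ∉ S

/-- An interpretation: a consistent set of literals containing, for each `p ∈ P`,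
exactly one of `p` and `¬p`. -/
def Interp {P : Type} (u : Set (Lit P)) : Prop :=
  ConsistentLits u ∧ ∀ p : P, (p, true) ∈ u ∨ (p, false) ∈ u

/-- An inference rule `λ → δ` among literals. -/
structure LitRule (P : Type) where
  lhs : Set (Lit P)
  rhs : Set (Lit P)

/-- A set of literals is closed under a set of rules. -/
def closedUnder {P : Type} (R : Set (LitRule P)) (w : Set (Lit P)) : Prop :=
  ∀ r ∈ R, r.lhs ⊆ w → r.rhs ⊆ w

/-- `C_R(w)`: the minimal (w.r.t. `⊆`) set of literals containing `w`
and closed under the rules in `R`. -/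
def CR {P : Type} (R : Set (LitRule P)) (w : Set (Lit P)) : Set (Lit P) :=
  ⋂₀ {w' | w ⊆ w' ∧ closedUnder R w'}

/-- `u'` is a result `u ⋆ φ` of revising the interpretation `u` by `φ` under rules `R`:
an interpretation `u'` with `u' = C_R((u ∩ u') ∪ φ)`. -/
def IsStar {P : Type} (R : Set (LitRule P)) (u φ u' : Set (Lit P)) : Prop :=
  Interp u' ∧ u' = CR R ((u ∩ u') ∪ φ)

theorem Lit.negate_negate {P : Type} (l : Lit P) : l.negate.negate = l := by
  simp [Lit.negate]

theorem mem_negSet {P : Type} {S : Set (Lit P)} {l : Lit P} :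
    l ∈ negSet S ↔ l.negate ∈ S := by
  constructor
  · rintro ⟨m, hm, rfl⟩
    rwa [Lit.negate_negate]
  · intro h
    exact ⟨l.negate, h, l.negate_negate⟩

theorem CR_empty {P : Type} (w : Set (Lit P)) : CR (∅ : Set (LitRule P)) w = w :=
  Set.Subset.antisymm
    (Set.sInter_subset_of_mem ⟨subset_rfl, fun _ hr => hr.elim⟩)
    (Set.subset_sInter fun _ h => h.1)

/-- Without rules, an interpretation `u'` with `φ ⊆ u' ⊆ u ∪ φ` is a result of revising
`u` by `φ`. -/
theorem Interp.isStar_empty {P : Type} {u φ u' : Set (Lit P)} (h : Interp u')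
    (hφ : φ ⊆ u') (hu : u' ⊆ u ∪ φ) : IsStar (∅ : Set (LitRule P)) u φ u' := by
  refine ⟨h, ?_⟩
  rw [CR_empty]
  refine Set.Subset.antisymm (fun l hl => ?_) (Set.union_subset Set.inter_subset_right hφ)
  exact (hu hl).imp (fun hlu => ⟨hlu, hl⟩) id

theorem Interp.mono {P : Type} {u v : Set (Lit P)} (hu : Interp u) (huv : u ⊆ v)
    (hv : ConsistentLits v) : Interp v :=
  ⟨hv, fun p => (hu.2 p).imp (fun h => huv h) (fun h => huv h)⟩

theorem Interp.update {P : Type} {u φ : Set (Lit P)} (hu : Interp u)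
    (hφ : ConsistentLits φ) : Interp ((u \ negSet φ) ∪ φ) := by
  constructor
  · rintro l (⟨hl, hn⟩ | hl) (⟨hl', hn'⟩ | hl')
    · exact hu.1 l hl hl'
    · exact hn (mem_negSet.2 hl')
    · exact hn' (mem_negSet.2 (by rwa [Lit.negate_negate]))
    · exact hφ l hl hl'
  · intro p
    have key : ∀ b, (p, b) ∈ u →
        (p, b) ∈ (u \ negSet φ) ∪ φ ∨ (p, !b) ∈ (u \ negSet φ) ∪ φ := by
      intro b hb
      by_cases h : (p, b) ∈ negSet φ
      · exact .inr (.inr (mem_negSet.1 h))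
      · exact .inl (.inl ⟨hb, h⟩)
    exact (hu.2 p).elim (key true) fun h => (key false h).symm

theorem star_empty_rules {P : Type} [Fintype P]
    (u φ ψ : Set (Lit P))
    (hu : Interp u) (hφ : ConsistentLits φ) (hψ : ConsistentLits ψ) :
    -- (i) `u ⋆ φ = (u ∖ ¬φ) ∪ φ`
    IsStar (∅ : Set (LitRule P)) u φ ((u \ negSet φ) ∪ φ) ∧
    -- (ii) if every literal of `ψ` belongs to `u ∖ ¬φ`, then `u ⋆ (φ ∪ ψ) = (u ⋆ φ) ∪ ψ`
    ((∀ l ∈ ψ, l ∈ u \ negSet φ) →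
      IsStar (∅ : Set (LitRule P)) u (φ ∪ ψ) (((u \ negSet φ) ∪ φ) ∪ ψ)) ∧
    -- (iii) if `(u ⋆ φ) ∪ ψ` is consistent, then `(u ⋆ φ) ∪ ψ = u ⋆ (φ ∪ ψ)`
    (ConsistentLits (((u \ negSet φ) ∪ φ) ∪ ψ) →
      IsStar (∅ : Set (LitRule P)) u (φ ∪ ψ) (((u \ negSet φ) ∪ φ) ∪ ψ)) := by
  have hX := hu.update hφ
  have hsub : (u \ negSet φ) ∪ φ ⊆ u ∪ φ := Set.union_subset_union_left _ Set.sdiff_subset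
  have hstar : Interp (((u \ negSet φ) ∪ φ) ∪ ψ) →
      IsStar (∅ : Set (LitRule P)) u (φ ∪ ψ) (((u \ negSet φ) ∪ φ) ∪ ψ) := fun h =>
    h.isStar_empty (Set.union_subset_union_left _ Set.subset_union_right)
      (by rw [← Set.union_assoc]; exact Set.union_subset_union_left _ hsub)
  refine ⟨hX.isStar_empty Set.subset_union_right hsub, fun h => hstar ?_,
    fun h => hstar (hX.mono Set.subset_union_left h)⟩
  rwa [Set.union_eq_self_of_subset_right (Set.subset_union_of_subset_left h φ)]
end
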